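/- Let B be a symmetric n×n real matrix, P a symmetric n×n real matrix with P² = P, g ∈ ℝⁿ, p = Pg, and τ > 0 such that τI + B is positive definite. Let d be the solution of (τI + B)d = −p. Then pᵀ(τI + B)⁻¹p ≥ ‖p‖²/(τ + ‖B‖), the identity |pᵀ(Pd)| = pᵀ(τI + B)⁻¹p holds, and consequently ‖p‖ ≤ (τ + ‖B‖)‖Pd‖. -/

import Mathlib

open Matrix

noncomputable def vecNorm {n : ℕ} (x : Fin n → ℝ) : ℝ :=
  ‖(WithLp.equiv 2 (Fin n → ℝ)).symm x‖

noncomputable def matNorm {n : ℕ} (M : Matrix (Fin n) (Fin n) ℝ) : ℝ :=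
  ‖Matrix.toEuclideanCLM (𝕜 := ℝ) M‖

lemma vecNorm_nonneg {n : ℕ} (x : Fin n → ℝ) : 0 ≤ vecNorm x := norm_nonneg _

lemma matNorm_nonneg {n : ℕ} (M : Matrix (Fin n) (Fin n) ℝ) : 0 ≤ matNorm M := norm_nonneg _

lemma dotProduct_self_eq_vecNorm_sq {n : ℕ} (x : Fin n → ℝ) : x ⬝ᵥ x = vecNorm x ^ 2 := by
  have h := EuclideanSpace.real_norm_sq_eq (WithLp.toLp 2 x)
  simp only [sq (x _)] at h
  exact h.symm

lemma abs_dotProduct_le_vecNorm_mul {n : ℕ} (x y : Fin n → ℝ) :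
    |x ⬝ᵥ y| ≤ vecNorm x * vecNorm y := by
  have h := abs_real_inner_le_norm (WithLp.toLp 2 x) (WithLp.toLp 2 y)
  rw [EuclideanSpace.inner_toLp_toLp, star_trivial, dotProduct_comm] at h
  exact h

lemma vecNorm_mulVec_le {n : ℕ} (M : Matrix (Fin n) (Fin n) ℝ) (x : Fin n → ℝ) :
    vecNorm (M *ᵥ x) ≤ matNorm M * vecNorm x :=
  (Matrix.toEuclideanCLM (𝕜 := ℝ) M).le_opNorm (WithLp.toLp 2 x)

lemma dotProduct_mulVec_le {n : ℕ} (M : Matrix (Fin n) (Fin n) ℝ) (x : Fin n → ℝ) :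
    x ⬝ᵥ (M *ᵥ x) ≤ matNorm M * vecNorm x ^ 2 := by
  calc x ⬝ᵥ (M *ᵥ x) ≤ vecNorm x * vecNorm (M *ᵥ x) :=
        (le_abs_self _).trans (abs_dotProduct_le_vecNorm_mul _ _)
    _ ≤ vecNorm x * (matNorm M * vecNorm x) :=
        mul_le_mul_of_nonneg_left (vecNorm_mulVec_le M x) (vecNorm_nonneg x)
    _ = matNorm M * vecNorm x ^ 2 := by ring

lemma Matrix.IsSymm.dotProduct_mulVec_comm {n : ℕ} {M : Matrix (Fin n) (Fin n) ℝ}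
    (hM : M.IsSymm) (x y : Fin n → ℝ) : x ⬝ᵥ (M *ᵥ y) = (M *ᵥ x) ⬝ᵥ y := by
  rw [dotProduct_mulVec, ← mulVec_transpose, hM.eq]

/-- If the quadratic form of a positive semidefinite `A` at `p = A y` is at most `c ‖p‖²`,
then `‖p‖² / c ≤ pᵀ y`. -/
lemma Matrix.PosSemidef.vecNorm_sq_div_le_dotProduct {n : ℕ} {A : Matrix (Fin n) (Fin n) ℝ}
    (hA : A.PosSemidef) {p y : Fin n → ℝ} (hy : A *ᵥ y = p) {c : ℝ} (hc : 0 < c)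
    (h : p ⬝ᵥ (A *ᵥ p) ≤ c * vecNorm p ^ 2) : vecNorm p ^ 2 / c ≤ p ⬝ᵥ y := by
  have hsymm : A.IsSymm := by simpa using hA.isHermitian
  have hyp : y ⬝ᵥ (A *ᵥ p) = vecNorm p ^ 2 := by
    rw [hsymm.dotProduct_mulVec_comm, hy, dotProduct_self_eq_vecNorm_sq]
  have hnn : 0 ≤ (c • y - p) ⬝ᵥ (A *ᵥ (c • y - p)) := by
    simpa using hA.dotProduct_mulVec_nonneg (c • y - p)
  simp only [mulVec_sub, mulVec_smul, hy, dotProduct_sub, sub_dotProduct, dotProduct_smul,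
    smul_dotProduct, smul_eq_mul, hyp, dotProduct_self_eq_vecNorm_sq] at hnn
  rw [dotProduct_comm y p] at hnn
  rw [div_le_iff₀ hc]
  have hmul : 0 ≤ c * (p ⬝ᵥ y * c - vecNorm p ^ 2) := by linarith
  linarith [nonneg_of_mul_nonneg_right hmul hc]

/-- bounds relating the projected gradient `p = Pg` and the
projected step `Pd`, where `(τI + B)d = −p`. -/
theorem projected_gradient_step_bounds {n : ℕ}
    (B : Matrix (Fin n) (Fin n) ℝ) (hBsymm : B.IsSymm)
    (P : Matrix (Fin n) (Fin n) ℝ) (hPsymm : P.IsSymm) (hPidem : P * P = P)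
    (g : Fin n → ℝ) (p : Fin n → ℝ) (hp : p = P *ᵥ g)
    (τ : ℝ) (hτ : 0 < τ)
    (hpd : (τ • (1 : Matrix (Fin n) (Fin n) ℝ) + B).PosDef)
    (d : Fin n → ℝ) (hd : (τ • (1 : Matrix (Fin n) (Fin n) ℝ) + B) *ᵥ d = -p) :
    vecNorm p ^ 2 / (τ + matNorm B)
        ≤ p ⬝ᵥ ((τ • (1 : Matrix (Fin n) (Fin n) ℝ) + B)⁻¹ *ᵥ p) ∧
    |p ⬝ᵥ (P *ᵥ d)| = p ⬝ᵥ ((τ • (1 : Matrix (Fin n) (Fin n) ℝ) + B)⁻¹ *ᵥ p) ∧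
    vecNorm p ≤ (τ + matNorm B) * vecNorm (P *ᵥ d) := by
  set A := τ • (1 : Matrix (Fin n) (Fin n) ℝ) + B with hA
  have hc : 0 < τ + matNorm B := by linarith [matNorm_nonneg B]
  have hinv : A⁻¹ *ᵥ p = -d := by
    rw [← neg_eq_iff_eq_neg.mpr hd, mulVec_neg, mulVec_mulVec,
      nonsing_inv_mul A ((isUnit_iff_isUnit_det A).mp hpd.isUnit), one_mulVec]
  have hy : A *ᵥ (-d) = p := by rw [mulVec_neg, hd, neg_neg]
  have hform : p ⬝ᵥ (A *ᵥ p) ≤ (τ + matNorm B) * vecNorm p ^ 2 := by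
    rw [hA, add_mulVec, smul_mulVec, one_mulVec, dotProduct_add, dotProduct_smul, smul_eq_mul,
      dotProduct_self_eq_vecNorm_sq]
    linarith [dotProduct_mulVec_le B p]
  have hlow := hpd.posSemidef.vecNorm_sq_div_le_dotProduct hy hc hform
  have hPp : P *ᵥ p = p := by rw [hp, mulVec_mulVec, hPidem]
  have hstep : |p ⬝ᵥ (P *ᵥ d)| = p ⬝ᵥ (-d) := by
    have hnn : 0 ≤ p ⬝ᵥ (-d) := le_trans (by positivity) hlow
    rw [hPsymm.dotProduct_mulVec_comm, hPp, ← abs_neg, ← dotProduct_neg, abs_of_nonneg hnn]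
  rw [hinv]
  refine ⟨hlow, hstep, ?_⟩
  have hle := hlow.trans (hstep.symm.le.trans (abs_dotProduct_le_vecNorm_mul p (P *ᵥ d)))
  rw [div_le_iff₀ hc] at hle
  rcases (vecNorm_nonneg p).eq_or_lt with h0 | hpos
  · rw [← h0]
    exact mul_nonneg hc.le (vecNorm_nonneg _)
  · refine le_of_mul_le_mul_left ?_ hpos
    linarith
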